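/- The set A_1 = {β > 1 : the sequence (ℓ_n(β))_{n≥1} is unbounded and limsup_{n→∞} ℓ_n(β)/n = 0} has full Lebesgue measure in (1,∞), i.e. its complement (1,∞) \ A_1 is Lebesgue null. -/

import Mathlib

open Filter MeasureTheory Set
open scoped ENNReal

/-- The β-transformation `T_β x = βx - ⌊βx⌋`. -/
noncomputable def betaT (β : ℝ) : ℝ → ℝ := fun x => β * x - (⌊β * x⌋ : ℝ)

/-- The digits of the β-expansion of 1: `epsDig β i = ε_{i+1}(1,β) = ⌊β · T_β^i 1⌋`. -/
noncomputable def epsDig (β : ℝ) (i : ℕ) : ℕ := (⌊β * (betaT β)^[i] 1⌋).toNat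

/-- Strict lexicographic order on words of length `m` (identified with their
extensions by zeros). -/
def wordLexLt (m : ℕ) (a b : ℕ → ℕ) : Prop :=
  ∃ k < m, (∀ j < k, a j = b j) ∧ a k < b k

/-- Non-strict lexicographic order on words of length `m`. -/
def wordLexLe (m : ℕ) (a b : ℕ → ℕ) : Prop :=
  wordLexLt m a b ∨ ∀ j < m, a j = b j

/-- A word `w = (w 0, …, w (n-1))` is self-admissible if `σ^i w ⪯ (w 0, …, w (n-1-i))`
for all `0 ≤ i < n`. -/
def SelfAdmissible (n : ℕ) (w : ℕ → ℕ) : Prop :=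
  ∀ i < n, wordLexLe (n - i) (fun j => w (i + j)) w

/-- The recurrence time `τ(w)` of a word of length `n`: the least `1 ≤ k < n` with
`σ^k w = (w 0, …, w (n-1-k))`, and `n` if no such `k` exists. -/
noncomputable def recTime (n : ℕ) (w : ℕ → ℕ) : ℕ :=
  sInf ({k | 1 ≤ k ∧ k < n ∧ ∀ j < n - k, w (k + j) = w j} ∪ {n})

/-- The cylinder of order `n` in the parameter space: the set of `β > 1` whose
β-expansion of 1 starts with the word `w`. -/
def cylP (n : ℕ) (w : ℕ → ℕ) : Set ℝ := {β | 1 < β ∧ ∀ i < n, epsDig β i = w i}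

open Classical in
/-- The infinite β-expansion of 1: if the expansion of 1 is finite with last
nonzero digit at (0-indexed) position `m`, it is `(ε_1, …, ε_m, ε_{m+1} - 1)^∞`;
otherwise it is the expansion of 1 itself. -/
noncomputable def epsStar (β : ℝ) : ℕ → ℕ :=
  if h : ∃ m, epsDig β m ≠ 0 ∧ ∀ i, m < i → epsDig β i = 0 then
    fun i => if i % (h.choose + 1) = h.choose then epsDig β h.choose - 1
             else epsDig β (i % (h.choose + 1))
  else epsDig β

/-- `runLenStar β n` is the number of consecutive zeros in `ε*(1,β)` just after
(1-indexed) index `n`, i.e. the largest `k` with `ε*_{n+1} = … = ε*_{n+k} = 0`. -/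
noncomputable def runLenStar (β : ℝ) (n : ℕ) : ℕ :=
  sSup {k | ∀ j < k, epsStar β (n + j) = 0}

/-- `runLen β n` is the number of consecutive zeros in `ε(1,β)` just after
(1-indexed) index `n`. -/
noncomputable def runLen (β : ℝ) (n : ℕ) : ℕ :=
  sSup {k | ∀ j < k, epsDig β (n + j) = 0}

/-- Strict lexicographic order on infinite sequences. -/
def seqLexLt (a b : ℕ → ℕ) : Prop := ∃ k, (∀ j < k, a j = b j) ∧ a k < b k

/-- Non-strict lexicographic order on infinite sequences. -/
def seqLexLe (a b : ℕ → ℕ) : Prop := seqLexLt a b ∨ a = b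

/-- The β-shift `S_β` (via Parry's criterion): all sequences whose every shift is
lexicographically at most `ε*(1,β)`. -/
def Sbeta (β : ℝ) : Set (ℕ → ℕ) := {w | ∀ i, seqLexLe (fun j => w (i + j)) (epsStar β)}

/-! ### Basic facts on the orbit of 1 -/

noncomputable def orb (β : ℝ) (n : ℕ) : ℝ := (betaT β)^[n] 1

lemma betaT_nonneg (β x : ℝ) : 0 ≤ betaT β x := by
  have := Int.floor_le (β * x)
  simp only [betaT]; linarith

lemma betaT_lt_one (β x : ℝ) : betaT β x < 1 := by
  have := Int.lt_floor_add_one (β * x)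
  simp only [betaT]; linarith

lemma toNat_floor_cast {y : ℝ} (hy : 0 ≤ y) : ((⌊y⌋.toNat : ℕ) : ℝ) = (⌊y⌋ : ℝ) := by
  have h : ((⌊y⌋.toNat : ℕ) : ℤ) = ⌊y⌋ := Int.toNat_of_nonneg (Int.floor_nonneg.mpr hy)
  exact_mod_cast congrArg (fun z : ℤ => (z : ℝ)) h

lemma orb_zero (β : ℝ) : orb β 0 = 1 := rfl

lemma orb_nonneg (β : ℝ) (n : ℕ) : 0 ≤ orb β n := by
  cases n with
  | zero => simp [orb_zero]
  | succ n => unfold orb; rw [Function.iterate_succ_apply']; exact betaT_nonneg _ _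

lemma orb_succ_lt (β : ℝ) (n : ℕ) : orb β (n+1) < 1 := by
  unfold orb; rw [Function.iterate_succ_apply']; exact betaT_lt_one _ _

lemma orb_le_one (β : ℝ) (n : ℕ) : orb β n ≤ 1 := by
  cases n with
  | zero => simp [orb_zero]
  | succ n => exact (orb_succ_lt β n).le

lemma orb_succ {β : ℝ} (hβ : 0 < β) (n : ℕ) :
    orb β (n+1) = β * orb β n - epsDig β n := by
  have h := toNat_floor_cast (mul_nonneg hβ.le (orb_nonneg β n))
  unfold epsDig
  unfold orb at *
  rw [h, Function.iterate_succ_apply']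
  rfl

lemma digit_unique {y : ℝ} {d : ℕ} (h0 : 0 ≤ y - d) (h1 : y - d < 1) : ⌊y⌋.toNat = d := by
  have : ⌊y⌋ = (d : ℤ) := by
    rw [Int.floor_eq_iff]; push_cast; constructor <;> linarith
  rw [this]; rfl

/-- The polynomial giving the orbit of 1 on the cylinder of `w`. -/
noncomputable def polyW (w : ℕ → ℕ) (β : ℝ) : ℕ → ℝ
  | 0 => 1
  | n+1 => β * polyW w β n - w n

lemma polyW_eq_orb {β : ℝ} (hβ : 0 < β) (w : ℕ → ℕ) (n : ℕ) (h : ∀ i < n, epsDig β i = w i) :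
    polyW w β n = orb β n := by
  induction n with
  | zero => rfl
  | succ n ih =>
    rw [polyW, ih (fun i hi => h i (by omega)), orb_succ hβ, h n (by omega)]

lemma digits_of_polyW {β : ℝ} (w : ℕ → ℕ) (n : ℕ)
    (h : ∀ m, m < n → 0 ≤ polyW w β (m+1) ∧ polyW w β (m+1) < 1) (hβ : 0 < β) :
    ∀ i < n, epsDig β i = w i := by
  induction n with
  | zero => intro i hi; omega
  | succ n ih =>
    have ih' := ih (fun m hm => h m (by omega))
    intro i hi
    rcases Nat.lt_succ_iff_lt_or_eq.mp hi with hi | rfl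
    · exact ih' i hi
    · have h1 := polyW_eq_orb hβ w i ih'
      have h2 := h i (by omega)
      simp only [polyW, h1] at h2
      exact digit_unique h2.1 h2.2

lemma polyW_growth (w : ℕ → ℕ) {β β' : ℝ} (h0 : 0 ≤ β) (hle : β ≤ β') (n : ℕ)
    (h : ∀ m ≤ n, 0 ≤ polyW w β m) :
    (β' - β) * β' ^ n ≤ polyW w β' (n+1) - polyW w β (n+1) := by
  induction n with
  | zero => simp [polyW]
  | succ n ih =>
    have ih' := ih (fun m hm => h m (by omega))
    have h1 := h (n+1) le_rfl
    rw [polyW, polyW.eq_2 w β (n+1)]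
    have e : β' * polyW w β' (n+1) - ↑(w (n+1)) - (β * polyW w β (n+1) - ↑(w (n+1)))
      = β' * (polyW w β' (n+1) - polyW w β (n+1)) + (β' - β) * polyW w β (n+1) := by ring
    rw [e]
    have h2 := mul_le_mul_of_nonneg_left ih' (h0.trans hle)
    have h3 : 0 ≤ (β' - β) * polyW w β (n+1) := mul_nonneg (by linarith) h1
    calc (β' - β) * β' ^ (n+1) = β' * ((β' - β) * β' ^ n) := by ring
      _ ≤ _ := by linarith

lemma polyW_mono (w : ℕ → ℕ) {β β' : ℝ} (h0 : 0 ≤ β) (hle : β ≤ β') (n : ℕ)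
    (h : ∀ m ≤ n, 0 ≤ polyW w β m) : polyW w β n ≤ polyW w β' n := by
  cases n with
  | zero => simp [polyW]
  | succ n =>
    have := polyW_growth w h0 hle n (fun m hm => h m (by omega))
    have h2 : 0 ≤ (β' - β) * β' ^ n := mul_nonneg (by linarith) (pow_nonneg (h0.trans hle) _)
    linarith

lemma polyW_cont (w : ℕ → ℕ) (n : ℕ) : Continuous (fun β => polyW w β n) := by
  induction n with
  | zero => simp only [polyW]; fun_prop
  | succ n ih => simp only [polyW]; fun_prop

lemma polyW_convex (w : ℕ → ℕ) {c β t : ℝ} (h0 : 0 ≤ c) (hle : c ≤ β) (ht0 : 0 ≤ t) (ht1 : t ≤ 1)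
    (n : ℕ) (h : ∀ m ≤ n, 0 ≤ polyW w c m) :
    polyW w (c + t * (β - c)) n ≤ (1 - t) * polyW w c n + t * polyW w β n := by
  induction n with
  | zero => simp [polyW]
  | succ n ih =>
    have ih' := ih (fun m hm => h m (by omega))
    have hm := polyW_mono w h0 hle n (fun m hm => h m (by omega))
    simp only [polyW]
    have hc : 0 ≤ c + t * (β - c) := add_nonneg h0 (mul_nonneg ht0 (by linarith))
    have h2 := mul_le_mul_of_nonneg_left ih' hc
    have h3 : 0 ≤ t * (1 - t) * ((β - c) * (polyW w β n - polyW w c n)) :=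
      mul_nonneg (mul_nonneg ht0 (by linarith)) (mul_nonneg (by linarith) (by linarith))
    nlinarith

/-! ### Runs of zeros -/

lemma orb_run {β : ℝ} (hβ : 1 < β) (n k : ℕ) (h : ∀ j < k, epsDig β (n + j) = 0) :
    orb β (n + k) = β ^ k * orb β n := by
  induction k with
  | zero => simp
  | succ k ih =>
    rw [← add_assoc, orb_succ (by linarith), h k (by omega), ih (fun j hj => h j (by omega))]
    push_cast; ring

lemma zeros_of_small {β : ℝ} (hβ : 1 < β) (n k : ℕ) (h : β ^ k * orb β n < 1) :
    ∀ j < k, epsDig β (n + j) = 0 := by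
  induction k with
  | zero => intro j hj; omega
  | succ k ih =>
    have hle : β ^ k * orb β n ≤ β ^ (k+1) * orb β n :=
      mul_le_mul_of_nonneg_right (pow_le_pow_right₀ hβ.le (by omega)) (orb_nonneg _ _)
    have ih' := ih (hle.trans_lt h)
    intro j hj
    rcases Nat.lt_succ_iff_lt_or_eq.mp hj with hj | rfl
    · exact ih' j hj
    · have h1 := orb_run hβ n j ih'
      have e : β * orb β (n + j) = β ^ (j+1) * orb β n := by rw [h1]; ring
      refine digit_unique (y := β * orb β (n + j)) (d := 0) ?_ ?_
      · have := mul_nonneg (by linarith : 0 ≤ β) (orb_nonneg β (n+j)); simpa using this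
      · rw [e]; simpa using h

/-! ### Unboundedness of the runs -/

lemma exists_left_end {β : ℝ} (hβ : 1 < β) (hne : ∀ n, orb β n ≠ 0) (n : ℕ) :
    ∃ c, 1 ≤ c ∧ c < β ∧ polyW (epsDig β) c (n+1) = 0 ∧
      ∀ m ≤ n+1, 0 ≤ polyW (epsDig β) c m := by
  have hb : (0:ℝ) < β := by linarith
  have hpos : ∀ m, 0 < polyW (epsDig β) β m := fun m => by
    rw [polyW_eq_orb hb _ _ (fun _ _ => rfl)]
    exact lt_of_le_of_ne (orb_nonneg _ _) (Ne.symm (hne m))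
  -- one step by the intermediate value theorem
  have step : ∀ n c, 1 ≤ c → c < β → (∀ m ≤ n, 0 ≤ polyW (epsDig β) c m) →
      polyW (epsDig β) c (n+1) ≤ 0 →
      ∃ c, 1 ≤ c ∧ c < β ∧ polyW (epsDig β) c (n+1) = 0 ∧
        ∀ m ≤ n+1, 0 ≤ polyW (epsDig β) c m := by
    intro n c h1 h2 h3 h4
    obtain ⟨d, hd, hd0⟩ := intermediate_value_Icc h2.le
      (polyW_cont (epsDig β) (n+1)).continuousOn ⟨h4, (hpos (n+1)).le⟩
    simp only at hd0
    refine ⟨d, h1.trans hd.1, lt_of_le_of_ne hd.2 ?_, hd0, ?_⟩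
    · rintro rfl; exact (hpos (n+1)).ne' hd0
    · intro m hm
      rcases Nat.le_succ_iff.mp hm with hm | rfl
      · exact (h3 m hm).trans (polyW_mono _ (by linarith) hd.1 m (fun i hi => h3 i (by omega)))
      · exact hd0.ge
  induction n with
  | zero =>
    refine step 0 1 le_rfl hβ (fun m hm => ?_) ?_
    · obtain rfl : m = 0 := by omega
      simp [polyW]
    · have h : (1:ℕ) ≤ epsDig β 0 := by
        have h1 : (1:ℤ) ≤ ⌊β * (betaT β)^[0] 1⌋ := by
          rw [Int.le_floor]; simpa using hβ.le
        unfold epsDig; omega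
      have h' : (1:ℝ) ≤ epsDig β 0 := by exact_mod_cast h
      simp only [polyW]; linarith
  | succ n ih =>
    obtain ⟨c, h1, h2, h3, h4⟩ := ih
    refine step (n+1) c h1 h2 h4 ?_
    rw [polyW, h3]; simp

lemma left_interval {β : ℝ} (hβ : 1 < β) (hne : ∀ n, orb β n ≠ 0) (k n : ℕ) :
    ∃ c, c < β ∧ (β - c) * β ^ n ≤ 1 ∧ ∀ t ∈ Ioo c (c + (β ^ k)⁻¹ * (β - c)),
      ∀ j < k, epsDig t (n + 1 + j) = 0 := by
  obtain ⟨c, h1, h2, h3, h4⟩ := exists_left_end hβ hne n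
  have hb : (0:ℝ) < β := by linarith
  have hP : ∀ m, polyW (epsDig β) β m = orb β m := fun m => polyW_eq_orb hb _ _ (fun _ _ => rfl)
  have hη1 : (β ^ k)⁻¹ ≤ 1 := inv_le_one_of_one_le₀ (one_le_pow₀ hβ.le)
  have hη0 : 0 < (β ^ k)⁻¹ := by positivity
  refine ⟨c, h2, ?_, ?_⟩
  · have := polyW_growth (epsDig β) (by linarith) h2.le n (fun m hm => h4 m (by omega))
    rw [h3, hP] at this
    linarith [orb_le_one β (n+1)]
  · intro t ht
    have htβ : t ≤ β := by
      have := mul_le_mul_of_nonneg_right hη1 (by linarith : 0 ≤ β - c)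
      linarith [ht.2]
    have htn : ∀ m ≤ n+1, 0 ≤ polyW (epsDig β) t m := fun m hm =>
      (h4 m hm).trans (polyW_mono _ (by linarith) ht.1.le m (fun i hi => h4 i (by omega)))
    have ht1 : 1 < t := by linarith [ht.1]
    have hdig := digits_of_polyW (β := t) (epsDig β) (n+1) (fun m hm => ⟨htn _ (by omega), by
      have := polyW_mono (epsDig β) (by linarith) htβ (m+1) (fun i hi => htn i (by omega))
      rw [hP] at this
      exact this.trans_lt (orb_succ_lt _ _)⟩) (by linarith)
    have horb := polyW_eq_orb (by linarith) _ _ hdig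
    refine zeros_of_small ht1 (n+1) k ?_
    rw [← horb]
    have m1 := polyW_mono (epsDig β) (by linarith) ht.2.le (n+1) htn
    have m2 := polyW_convex (epsDig β) (by linarith) h2.le hη0.le hη1 (n+1) h4
    rw [h3, hP] at m2
    have m3 : polyW (epsDig β) t (n+1) < (β ^ k)⁻¹ := by
      have := mul_lt_mul_of_pos_left (orb_succ_lt β n) hη0
      linarith
    calc t ^ k * polyW (epsDig β) t (n+1) ≤ β ^ k * polyW (epsDig β) t (n+1) :=
          mul_le_mul_of_nonneg_right (pow_le_pow_left₀ (by linarith) htβ k) (htn _ le_rfl)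
      _ < β ^ k * (β ^ k)⁻¹ := mul_lt_mul_of_pos_left m3 (by positivity)
      _ = 1 := mul_inv_cancel₀ (by positivity)

/-- Parameters without a run of `k` zeros. -/
def noRun (k : ℕ) : Set ℝ := {β | 1 < β ∧ ∀ n, ∃ j < k, epsDig β (n + j) ≠ 0}

lemma noRun_null (k : ℕ) : volume (noRun k) = 0 := by
  have hd := Besicovitch.ae_tendsto_measure_inter_div (volume : Measure ℝ) (noRun k)
  have hF : ∀ β ∈ noRun k, ¬ Tendsto (fun r => volume (noRun k ∩ Metric.closedBall β r) /
      volume (Metric.closedBall β r)) (nhdsWithin 0 (Ioi 0)) (nhds 1) := by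
    intro β hβ hT
    have hβ1 := hβ.1
    have hne : ∀ n, orb β n ≠ 0 := by
      intro n hn
      obtain ⟨j, hj, hj'⟩ := hβ.2 n
      exact hj' (zeros_of_small hβ1 n k (by rw [hn]; simp) j hj)
    choose c hc1 hc2 hc3 using left_interval hβ1 hne k
    have hr : Tendsto (fun n => β - c n) atTop (nhdsWithin 0 (Ioi 0)) := by
      rw [tendsto_nhdsWithin_iff]
      refine ⟨?_, Eventually.of_forall fun n => ?_⟩
      · refine squeeze_zero (g := fun n => (β⁻¹) ^ n) (fun n => by linarith [hc1 n]) (fun n => ?_)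
          (tendsto_pow_atTop_nhds_zero_of_lt_one (by positivity) (inv_lt_one_of_one_lt₀ hβ1))
        rw [inv_pow, ← one_div, le_div_iff₀ (by positivity)]
        exact hc2 n
      · simpa using hc1 n
    set η := (β ^ k)⁻¹ with hη
    have hη1 : η ≤ 1 := inv_le_one_of_one_le₀ (one_le_pow₀ hβ1.le)
    have hη0 : 0 < η := by positivity
    have hT2 := hT.comp hr
    have hlt : ENNReal.ofReal (1 - η / 2) < 1 := by
      rw [← ENNReal.ofReal_one]
      exact (ENNReal.ofReal_lt_ofReal_iff one_pos).2 (by linarith)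
    have hle : (1:ℝ≥0∞) ≤ ENNReal.ofReal (1 - η / 2) := by
      refine le_of_tendsto hT2 (Eventually.of_forall fun n => ?_)
      simp only [Function.comp]
      have hrn : 0 < β - c n := by linarith [hc1 n]
      set r := β - c n with hrdef
      have hsub : noRun k ∩ Metric.closedBall β r ⊆
          Metric.closedBall β r \ Ioo (c n) (c n + η * r) := by
        rintro t ⟨ht, htb⟩
        refine ⟨htb, fun hti => ?_⟩
        obtain ⟨j, hj, hj'⟩ := ht.2 (n+1)
        exact hj' (hc3 n t hti j hj)
      have hηr : η * r ≤ r := by nlinarith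
      have hIoo : Ioo (c n) (c n + η * r) ⊆ Metric.closedBall β r := by
        intro t ht
        rw [Real.closedBall_eq_Icc]
        constructor <;> [linarith [ht.1]; linarith [ht.2]]
      have hvol : volume (Metric.closedBall β r \ Ioo (c n) (c n + η * r)) =
          ENNReal.ofReal (2 * r - η * r) := by
        rw [measure_sdiff hIoo measurableSet_Ioo.nullMeasurableSet (by simp [Real.volume_Ioo]),
          Real.volume_closedBall, Real.volume_Ioo, ← ENNReal.ofReal_sub _ (by nlinarith)]
        congr 1; ring
      rw [Real.volume_closedBall]
      refine ENNReal.div_le_of_le_mul ?_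
      refine (measure_mono hsub).trans ?_
      rw [hvol, ← ENNReal.ofReal_mul (by linarith)]
      apply ENNReal.ofReal_le_ofReal
      nlinarith
    exact absurd hle (not_le.mpr hlt)
  -- conclude
  rw [ae_iff] at hd
  have hsub : noRun k ⊆ {a | ¬ Tendsto (fun r => volume (noRun k ∩ Metric.closedBall a r) /
      volume (Metric.closedBall a r)) (nhdsWithin 0 (Ioi 0)) (nhds 1)} := hF
  have h2 := Measure.le_restrict_apply (μ := volume) (noRun k) {a | ¬ Tendsto (fun r => volume (noRun k ∩ Metric.closedBall a r) /
      volume (Metric.closedBall a r)) (nhdsWithin 0 (Ioi 0)) (nhds 1)}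
  rw [hd, inter_eq_self_of_subset_right hsub] at h2
  exact le_antisymm h2 bot_le

/-! ### Counting cylinders -/

noncomputable def wordL (β : ℝ) : ℝ → ℕ → List ℕ
  | _, 0 => []
  | x, n+1 => ⌊β * x⌋.toNat :: wordL β (betaT β x) n

lemma wordL_dig {β β' : ℝ} (n : ℕ) : ∀ x x' : ℝ, wordL β x n = wordL β' x' n → ∀ i < n,
    ⌊β * (betaT β)^[i] x⌋.toNat = ⌊β' * (betaT β')^[i] x'⌋.toNat := by
  induction n with
  | zero => intro x x' _ i hi; omega
  | succ n ih =>
    intro x x' h i hi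
    simp only [wordL, List.cons.injEq] at h
    cases i with
    | zero => simpa using h.1
    | succ i => exact ih _ _ h.2 i (by omega)

lemma count_words {b : ℝ} (hb : 1 < b) (n : ℕ) : ∀ y : ℝ, 0 ≤ y → y ≤ 1 →
    ∃ S : Finset (List ℕ), (S.card : ℝ) ≤ n * b ^ n * y + 1 ∧
      ∀ β, 1 < β → β ≤ b → ∀ x, 0 ≤ x → x ≤ y → wordL β x n ∈ S := by
  induction n with
  | zero => intro y _ _; exact ⟨{[]}, by simp, by simp [wordL]⟩
  | succ n ih =>
    intro y hy0 hy1
    obtain ⟨S0, hS0, hm0⟩ := ih 1 (by norm_num) le_rfl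
    obtain ⟨S1, hS1, hm1⟩ := ih (betaT b y) (betaT_nonneg _ _) (betaT_lt_one _ _).le
    have hby : 0 ≤ b * y := mul_nonneg (by linarith) hy0
    set d := ⌊b * y⌋.toNat with hd
    have hdc : (d : ℝ) = (⌊b * y⌋ : ℝ) := toNat_floor_cast hby
    have hT : betaT b y = b * y - d := by rw [hdc]; rfl
    refine ⟨(Finset.range d).biUnion (fun c => S0.image (fun l => c :: l)) ∪
      S1.image (fun l => d :: l), ?_, ?_⟩
    · have c1 : ((Finset.range d).biUnion (fun c => S0.image (fun l => c :: l))).card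
          ≤ d * S0.card := by
        refine (Finset.card_biUnion_le_card_mul _ _ S0.card
          (fun c _ => Finset.card_image_le)).trans ?_
        simp
      have c2 : ((Finset.range d).biUnion (fun c => S0.image (fun l => c :: l)) ∪
          S1.image (fun l => d :: l)).card ≤ d * S0.card + S1.card :=
        (Finset.card_union_le _ _).trans (add_le_add c1 Finset.card_image_le)
      have c3 : (((Finset.range d).biUnion (fun c => S0.image (fun l => c :: l)) ∪
          S1.image (fun l => d :: l)).card : ℝ) ≤ d * S0.card + S1.card := by exact_mod_cast c2
      have hd0 : (0:ℝ) ≤ d := Nat.cast_nonneg _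
      have hdle : (d:ℝ) ≤ b * y := by rw [hdc]; exact Int.floor_le _
      have c4 := mul_le_mul_of_nonneg_left hS0 hd0
      rw [hT] at hS1
      have hbn : 1 ≤ b ^ n := one_le_pow₀ hb.le
      have c5 : b * y ≤ b ^ (n+1) * y := by
        rw [pow_succ]; nlinarith
      push_cast
      calc _ ≤ _ := c3
        _ ≤ d * (n * b ^ n * 1 + 1) + (n * b ^ n * (b * y - d) + 1) := add_le_add c4 hS1
        _ = n * b ^ (n+1) * y + d + 1 := by ring
        _ ≤ n * b ^ (n+1) * y + b ^ (n+1) * y + 1 := by linarith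
        _ = _ := by ring
    · intro β h1 h2 x hx0 hxy
      have hx : 0 ≤ β * x := mul_nonneg (by linarith) hx0
      have hle : β * x ≤ b * y := mul_le_mul h2 hxy hx0 (by linarith)
      have hdl : ⌊β * x⌋.toNat ≤ d := Int.toNat_le_toNat (Int.floor_le_floor hle)
      rw [wordL, Finset.mem_union]
      rcases Nat.lt_or_eq_of_le hdl with h | h
      · left
        rw [Finset.mem_biUnion]
        exact ⟨_, Finset.mem_range.2 h, Finset.mem_image.2
          ⟨_, hm0 β h1 h2 _ (betaT_nonneg _ _) (betaT_lt_one _ _).le, rfl⟩⟩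
      · right
        rw [h]
        refine Finset.mem_image.2 ⟨_, hm1 β h1 h2 _ (betaT_nonneg _ _) ?_, rfl⟩
        have := toNat_floor_cast hx
        rw [hT, ← h, this]
        simp only [betaT]; linarith

/-! ### Orbits do not approach zero exponentially fast -/

def smallSet (a b ρ : ℝ) (n : ℕ) : Set ℝ := {β | a ≤ β ∧ β ≤ b ∧ orb β (n+1) < ρ ^ (n+1)}

lemma smallSet_vol {a b ρ : ℝ} (ha : 1 < a) (hab : a < b) (hρ : 0 < ρ) (n : ℕ) :
    volume (smallSet a b ρ n) ≤
      ENNReal.ofReal (a * (((n+1 : ℕ):ℝ) * (b * ρ / a) ^ (n+1) + (b * ρ / a) ^ (n+1))) := by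
  have hb : 1 < b := by linarith
  obtain ⟨S, hS, hm⟩ := count_words hb (n+1) 1 (by norm_num) le_rfl
  have hsub : smallSet a b ρ n ⊆
      ⋃ l ∈ S, {β | β ∈ smallSet a b ρ n ∧ wordL β 1 (n+1) = l} := by
    intro β hβ
    simp only [mem_iUnion]
    exact ⟨_, hm β (by linarith [hβ.1]) hβ.2.1 1 (by norm_num) le_rfl, hβ, rfl⟩
  have key : ∀ l, ∀ β ∈ {β | β ∈ smallSet a b ρ n ∧ wordL β 1 (n+1) = l},
      ∀ β' ∈ {β | β ∈ smallSet a b ρ n ∧ wordL β 1 (n+1) = l}, β ≤ β' →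
      β' - β ≤ ρ ^ (n+1) / a ^ n := by
    rintro l β ⟨hβ, hl⟩ β' ⟨hβ', hl'⟩ hle
    have hdig : ∀ i < n+1, epsDig β' i = epsDig β i := wordL_dig (n+1) 1 1 (hl'.trans hl.symm)
    have p0 : 0 < β := by linarith [hβ.1]
    have p0' : 0 < β' := by linarith
    have e' := polyW_eq_orb p0' _ _ hdig
    have e : ∀ m, polyW (epsDig β) β m = orb β m := fun m => polyW_eq_orb p0 _ _ (fun _ _ => rfl)
    have g := polyW_growth (epsDig β) p0.le hle n (fun m _ => by rw [e]; exact orb_nonneg _ _)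
    rw [e', e] at g
    rw [le_div_iff₀ (by positivity)]
    have : (β' - β) * a ^ n ≤ (β' - β) * β' ^ n :=
      mul_le_mul_of_nonneg_left (pow_le_pow_left₀ (by linarith) (by linarith [hβ.1]) n)
        (by linarith)
    linarith [hβ'.2.2, orb_nonneg β (n+1)]
  have hpiece : ∀ l, volume {β | β ∈ smallSet a b ρ n ∧ wordL β 1 (n+1) = l} ≤
      ENNReal.ofReal (ρ ^ (n+1) / a ^ n) := by
    intro l
    refine (Real.volume_le_diam _).trans (Metric.ediam_le fun β hβ β' hβ' => ?_)
    rw [edist_dist]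
    apply ENNReal.ofReal_le_ofReal
    rw [Real.dist_eq]
    rcases le_total β β' with h | h
    · rw [abs_sub_comm, abs_of_nonneg (by linarith)]; exact key l β hβ β' hβ' h
    · rw [abs_of_nonneg (by linarith)]; exact key l β' hβ' β hβ h
  calc volume (smallSet a b ρ n) ≤ _ := measure_mono hsub
    _ ≤ ∑ l ∈ S, volume {β | β ∈ smallSet a b ρ n ∧ wordL β 1 (n+1) = l} :=
        measure_biUnion_finset_le _ _
    _ ≤ ∑ l ∈ S, ENNReal.ofReal (ρ ^ (n+1) / a ^ n) := Finset.sum_le_sum fun l _ => hpiece l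
    _ = ENNReal.ofReal (S.card * (ρ ^ (n+1) / a ^ n)) := by
        rw [Finset.sum_const, nsmul_eq_mul, ENNReal.ofReal_mul (Nat.cast_nonneg _),
          ENNReal.ofReal_natCast]
    _ ≤ _ := by
        apply ENNReal.ofReal_le_ofReal
        have hbn : 1 ≤ b ^ (n+1) := one_le_pow₀ hb.le
        have h2 : (S.card : ℝ) ≤ ((n+1 : ℕ):ℝ) * b ^ (n+1) + b ^ (n+1) := by linarith
        have h3 : 0 ≤ ρ ^ (n+1) / a ^ n := by positivity
        refine (mul_le_mul_of_nonneg_right h2 h3).trans (le_of_eq ?_)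
        have ha0 : a ≠ 0 := by linarith
        rw [div_pow, mul_pow]
        field_simp
        ring

def badSet (ρ : ℝ) : Set ℝ := {β | 1 < β ∧ ∃ᶠ n in atTop, orb β (n+1) < ρ ^ (n+1)}

lemma badSet_null {ρ : ℝ} (h0 : 0 < ρ) (h1 : ρ < 1) : volume (badSet ρ) = 0 := by
  apply measure_null_of_locally_null
  intro β hβ
  have hβ1 := hβ.1
  -- a neighbourhood `[a,b]` with `b ρ < a`
  obtain ⟨a, ha1, ha2⟩ := exists_between (max_lt hβ1 (by nlinarith : β * ρ < β))
  have ha : 1 < a := (le_max_left _ _).trans_lt ha1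
  have ha' : β * ρ < a := (le_max_right _ _).trans_lt ha1
  obtain ⟨b, hb1, hb2⟩ := exists_between ((lt_div_iff₀ h0).2 ha')
  have hba : b * ρ < a := (lt_div_iff₀ h0).1 hb2
  have hab : a < b := by linarith
  refine ⟨badSet ρ ∩ Icc a b, inter_mem self_mem_nhdsWithin
    (mem_nhdsWithin_of_mem_nhds (Icc_mem_nhds ha2 hb1)), ?_⟩
  have hq0 : 0 ≤ b * ρ / a := by
    have : 0 < b := by linarith
    positivity
  have hq1 : b * ρ / a < 1 := (div_lt_one (by linarith)).2 hba
  have hs1 : Summable (fun n : ℕ => (n:ℝ) * (b * ρ / a) ^ n + (b * ρ / a) ^ n) := by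
    refine Summable.add ?_ (summable_geometric_of_lt_one hq0 hq1)
    simpa using summable_pow_mul_geometric_of_norm_lt_one 1
      (r := b * ρ / a) (by rwa [Real.norm_of_nonneg hq0])
  have hs2 := ((summable_nat_add_iff 1).2 hs1).mul_left a
  have hsum : ∑' n, volume (smallSet a b ρ n) ≠ ⊤ := by
    refine ne_top_of_le_ne_top ?_ (ENNReal.tsum_le_tsum fun n => smallSet_vol ha hab h0 n)
    exact hs2.tsum_ofReal_ne_top
  have hae := ae_eventually_notMem hsum
  rw [ae_iff] at hae
  refine measure_mono_null ?_ hae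
  rintro t ⟨ht, htI⟩
  simp only [mem_ofPred_eq, not_eventually, not_not]
  exact ht.2.mono fun n hn => ⟨htI.1, htI.2, hn⟩

/-! ### Conclusion -/

lemma good_of {β : ℝ} (hβ : 1 < β) (hrun : ∀ k, β ∉ noRun k)
    (hgood : ∀ m : ℕ, β ∉ badSet (1 - 1 / ((m:ℝ) + 2))) :
    (¬ BddAbove (Set.range fun n : ℕ => runLenStar β n)) ∧
      limsup (fun n : ℕ => (runLenStar β n : ℝ≥0∞) / (n : ℝ≥0∞)) atTop = 0 := by
  have hρ : ∀ m : ℕ, 0 < 1 - 1 / ((m:ℝ) + 2) := fun m => by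
    have : 1 / ((m:ℝ) + 2) < 1 := by
      rw [div_lt_one (by positivity)]
      have : (0:ℝ) ≤ m := Nat.cast_nonneg m
      linarith
    linarith
  have hg : ∀ m : ℕ, ∀ᶠ n in atTop, (1 - 1 / ((m:ℝ) + 2)) ^ n ≤ orb β n := by
    intro m
    have h := hgood m
    simp only [badSet, mem_ofPred_eq, not_and, not_frequently, not_lt] at h
    have h2 := h hβ
    obtain ⟨N, hN⟩ := eventually_atTop.1 h2
    refine eventually_atTop.2 ⟨N + 1, fun n hn => ?_⟩
    obtain ⟨i, rfl⟩ : ∃ i, n = i + 1 := ⟨n - 1, by omega⟩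
    exact hN i (by omega)
  have hrunle : ∀ n k, (∀ j < k, epsDig β (n + j) = 0) → β ^ k * orb β n ≤ 1 := by
    intro n k h
    rw [← orb_run hβ n k h]; exact orb_le_one _ _
  have hpos : ∀ m, ∃ n ≥ m, 0 < orb β n := by
    intro m
    obtain ⟨n, h1, h2⟩ := ((hg 0).and (eventually_ge_atTop m)).exists
    exact ⟨n, h2, (pow_pos (hρ 0) n).trans_le h1⟩
  have hinf : ∀ m, ∃ i, m < i ∧ epsDig β i ≠ 0 := by
    intro m
    by_contra! hcon
    obtain ⟨n, hn, hn0⟩ := hpos (m+1)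
    have hle : ∀ k : ℕ, β ^ k ≤ (orb β n)⁻¹ := by
      intro k
      rw [← one_div, le_div_iff₀ hn0]
      exact hrunle n k (fun j _ => hcon _ (by omega))
    obtain ⟨k, hk⟩ := pow_unbounded_of_one_lt (orb β n)⁻¹ hβ
    exact absurd (hle k) (not_le.mpr hk)
  have hstar : epsStar β = epsDig β := by
    unfold epsStar
    rw [dif_neg]
    rintro ⟨m, _, hm⟩
    obtain ⟨i, hi, hi'⟩ := hinf m
    exact hi' (hm i hi)
  have hbdd : ∀ n, BddAbove {k | ∀ j < k, epsDig β (n + j) = 0} := by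
    intro n
    obtain ⟨i, hi, hi'⟩ := hinf n
    refine ⟨i - n, fun k hk => ?_⟩
    by_contra hlt
    exact hi' (by have := hk (i - n) (by omega); rwa [Nat.add_sub_cancel' hi.le] at this)
  have hmem : ∀ n, ∀ j < runLenStar β n, epsDig β (n + j) = 0 := by
    intro n
    unfold runLenStar
    rw [hstar]
    exact Nat.sSup_mem (s := {k | ∀ j < k, epsDig β (n + j) = 0}) ⟨0, by simp⟩ (hbdd n)
  constructor
  · rintro ⟨K, hK⟩
    have h := hrun (K+1)
    simp only [noRun, mem_ofPred_eq, not_and, not_forall, not_exists, not_not] at h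
    obtain ⟨n, hn⟩ := h hβ
    have h1 : K + 1 ≤ runLenStar β n := by
      unfold runLenStar
      rw [hstar]
      exact le_csSup (hbdd n) (fun j hj => hn j hj)
    have h2 : runLenStar β n ≤ K := hK ⟨n, rfl⟩
    omega
  · apply Tendsto.limsup_eq
    rw [ENNReal.tendsto_nhds_zero]
    intro ε hε
    -- a positive real below ε
    obtain ⟨δ, hδ0, hδ⟩ := ENNReal.lt_iff_exists_nnreal_btwn.1 hε
    have hδ0' : (0:ℝ) < δ := by exact_mod_cast hδ0
    have hlog : 0 < Real.log β := Real.log_pos hβ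
    -- choose m
    have hlim : Tendsto (fun m : ℕ => Real.log (1 - 1 / ((m:ℝ) + 2))) atTop (nhds 0) := by
      have h1 : Tendsto (fun m : ℕ => 1 - 1 / ((m:ℝ) + 2)) atTop (nhds 1) := by
        have h2 : Tendsto (fun m : ℕ => 1 / ((m:ℝ) + 2)) atTop (nhds 0) := by
          refine Tendsto.div_atTop tendsto_const_nhds ?_
          exact tendsto_atTop_add_const_right _ _ tendsto_natCast_atTop_atTop
        simpa using tendsto_const_nhds.sub h2
      have := (Real.continuousAt_log one_ne_zero).tendsto.comp h1
      simpa [Function.comp_def] using this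
    obtain ⟨m, hm⟩ := (hlim.eventually_const_lt
      (by nlinarith : -((δ:ℝ) * Real.log β) < 0)).exists
    filter_upwards [hg m, eventually_gt_atTop 0] with n hn hn0
    have h1 := hrunle n _ (hmem n)
    have h2 : β ^ (runLenStar β n) * (1 - 1 / ((m:ℝ) + 2)) ^ n ≤ 1 :=
      (mul_le_mul_of_nonneg_left hn (by positivity)).trans h1
    have hρm := hρ m
    have h3 := Real.log_le_log (by positivity) h2
    rw [Real.log_mul (by positivity) (by positivity), Real.log_pow, Real.log_pow,
      Real.log_one] at h3
    have hn0' : (0:ℝ) < n := by exact_mod_cast hn0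
    have h4 : (runLenStar β n : ℝ) * Real.log β ≤ (δ * n) * Real.log β := by
      have := mul_le_mul_of_nonneg_left hm.le hn0'.le
      nlinarith
    have h5 : (runLenStar β n : ℝ) ≤ δ * n := le_of_mul_le_mul_right h4 hlog
    have h6 : (runLenStar β n : ℝ≥0∞) ≤ (δ : ℝ≥0∞) * n := by
      have : (runLenStar β n : NNReal) ≤ δ * n := by exact_mod_cast h5
      exact_mod_cast this
    exact (ENNReal.div_le_of_le_mul h6).trans hδ.le

/-- Proposition 8.3. The set
`A₁ = {β > 1 : (ℓ_n(β)) is unbounded and limsup ℓ_n(β)/n = 0}` has full Lebesgue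
measure in `(1,∞)`. -/
theorem A1_full_measure :
    volume (Ioi (1:ℝ) \ {β : ℝ | 1 < β ∧
        (¬ BddAbove (Set.range fun n : ℕ => runLenStar β n)) ∧
        limsup (fun n : ℕ => (runLenStar β n : ℝ≥0∞) / (n : ℝ≥0∞)) atTop = 0}) = 0 := by
  have hnull : volume ((⋃ k, noRun k) ∪ ⋃ m : ℕ, badSet (1 - 1 / ((m:ℝ) + 2))) = 0 := by
    rw [measure_union_null_iff, measure_iUnion_null_iff, measure_iUnion_null_iff]
    refine ⟨noRun_null, fun m => badSet_null ?_ ?_⟩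
    · have : 1 / ((m:ℝ) + 2) < 1 := by
        rw [div_lt_one (by positivity)]
        have : (0:ℝ) ≤ m := Nat.cast_nonneg m
        linarith
      linarith
    · have : 0 < 1 / ((m:ℝ) + 2) := by positivity
      linarith
  refine measure_mono_null ?_ hnull
  rintro β ⟨hβ, hn⟩
  by_contra hcon
  simp only [mem_union, mem_iUnion, not_or, not_exists] at hcon
  exact hn ⟨hβ, good_of hβ hcon.1 hcon.2⟩
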